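/- Let τ lie in the complex upper half-plane. Then (𝔟(τ) + 2)⁴·𝔟(4τ)⁴ = 2⁸·(𝔟(τ)³ + 4·𝔟(τ)). -/

import Mathlib

/-- `qpow τ r = exp(2πi·r·τ)`, i.e. `q^r` where `q = exp(2πiτ)`. -/
noncomputable def qpow (τ : ℂ) (r : ℝ) : ℂ :=
  Complex.exp (2 * (Real.pi : ℂ) * Complex.I * (r : ℂ) * τ)

/-- `𝔟(τ) = 2 ∏_{n≥1} ((1 - q^{n/2 - 1/4})/(1 + q^{n/2 - 1/4}))²`. -/
noncomputable def bWeb (τ : ℂ) : ℂ :=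
  2 * ∏' n : ℕ,
    ((1 - qpow τ (((n : ℝ) + 1) / 2 - 1/4)) / (1 + qpow τ (((n : ℝ) + 1) / 2 - 1/4))) ^ 2

open Filter Topology

/-- The finite Euler product `∏_{k=1}^n (1 - p^k)`. -/
noncomputable def eulerPartial (p : ℂ) (n : ℕ) : ℂ :=
  ∏ k ∈ Finset.range n, (1 - p ^ (k + 1))

/-- The inverse of `eulerPartial`, extended by zero to negative indices. -/
noncomputable def eulerPartialInv (p : ℂ) (m : ℤ) : ℂ :=
  if 0 ≤ m then (eulerPartial p m.toNat)⁻¹ else 0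

/-- The Gaussian binomial coefficient `[2N, N + j]` in base `p`. -/
noncomputable def centralGaussBinom (p : ℂ) (N : ℕ) (j : ℤ) : ℂ :=
  eulerPartial p (2 * N) * eulerPartialInv p (N + j) * eulerPartialInv p (N - j)

/-- The theta series `∑ z^j x^(j²)` over the integers. -/
noncomputable def thetaSeries (z x : ℂ) : ℂ := ∑' j : ℤ, z ^ j * x ^ (j ^ 2)

lemma one_sub_pow_ne_zero_of_norm_lt_one {p : ℂ} (hp : ‖p‖ < 1) (k : ℕ) :
    1 - p ^ (k + 1) ≠ 0 := by
  intro h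
  have h1 : ‖p ^ (k + 1)‖ < 1 := by
    rw [norm_pow]; exact pow_lt_one₀ (norm_nonneg _) hp (by omega)
  rw [← sub_eq_zero.mp h] at h1
  simp at h1

lemma eulerPartial_ne_zero {p : ℂ} (hp : ‖p‖ < 1) (n : ℕ) : eulerPartial p n ≠ 0 :=
  Finset.prod_ne_zero_iff.mpr fun k _ => one_sub_pow_ne_zero_of_norm_lt_one hp k

lemma eulerPartialInv_sub_one {p : ℂ} (hp : ‖p‖ < 1) (m : ℤ) :
    eulerPartialInv p (m - 1) = (1 - p ^ m) * eulerPartialInv p m := by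
  rcases lt_trichotomy m 0 with h | rfl | h
  · simp [eulerPartialInv, not_le.mpr h, show ¬ (1 ≤ m) by omega]
  · simp [eulerPartialInv]
  · obtain ⟨n, rfl⟩ : ∃ n : ℕ, m = n + 1 := ⟨(m - 1).toNat, by omega⟩
    have h2 : ((n : ℤ) + 1).toNat = n + 1 := by omega
    have h3 : p ^ ((n : ℤ) + 1) = p ^ (n + 1) := by exact_mod_cast zpow_natCast p (n + 1)
    have := one_sub_pow_ne_zero_of_norm_lt_one hp n
    have := eulerPartial_ne_zero hp n
    rw [eulerPartialInv, eulerPartialInv, if_pos (by omega), if_pos (by omega), h2, h3,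
      add_sub_cancel_right, Int.toNat_natCast]
    simp only [eulerPartial, Finset.prod_range_succ] at *
    field_simp

lemma summable_norm_pow_mul_add {x : ℂ} (hx : ‖x‖ < 1) {a : ℕ} (ha : 0 < a) (b : ℕ) :
    Summable fun k : ℕ => ‖x ^ (a * k + b)‖ := by
  have : ‖x‖ ^ a < 1 := pow_lt_one₀ (norm_nonneg _) hx ha.ne'
  simpa [pow_add, pow_mul] using
    (summable_geometric_of_lt_one (by positivity) this).mul_right (‖x‖ ^ b)

lemma exists_tendsto_eulerPartial {p : ℂ} (hp : ‖p‖ < 1) :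
    ∃ E : ℂ, E ≠ 0 ∧ Tendsto (eulerPartial p) atTop (𝓝 E) := by
  have hs : Summable fun k : ℕ => ‖-p ^ (k + 1)‖ := by
    simpa using summable_norm_pow_mul_add hp one_pos 1
  refine ⟨∏' k : ℕ, (1 + -p ^ (k + 1)), tprod_one_add_ne_zero_of_summable ?_ hs, ?_⟩
  · intro k
    simpa [sub_eq_add_neg] using one_sub_pow_ne_zero_of_norm_lt_one hp k
  · refine (multipliable_one_add_of_summable hs).hasProd.tendsto_prod_nat.congr fun n => ?_
    simp [eulerPartial, sub_eq_add_neg]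

lemma exists_norm_eulerPartialInv_le {p : ℂ} (hp : ‖p‖ < 1) :
    ∃ C : ℝ, ∀ m, ‖eulerPartialInv p m‖ ≤ C := by
  obtain ⟨E, hE, h⟩ := exists_tendsto_eulerPartial hp
  obtain ⟨C, hC⟩ :=
    (Metric.isBounded_range_of_tendsto _ (h.inv₀ hE)).exists_norm_le
  refine ⟨C, fun m => ?_⟩
  have h0 : ∀ n : ℕ, ‖(eulerPartial p n)⁻¹‖ ≤ C := fun n => hC _ ⟨n, rfl⟩
  unfold eulerPartialInv
  split_ifs
  · exact h0 _
  · simpa using (norm_nonneg _).trans (h0 0)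

lemma exists_norm_centralGaussBinom_le {p : ℂ} (hp : ‖p‖ < 1) :
    ∃ C : ℝ, ∀ N j, ‖centralGaussBinom p N j‖ ≤ C := by
  obtain ⟨E, -, h⟩ := exists_tendsto_eulerPartial hp
  obtain ⟨C, hC⟩ := (Metric.isBounded_range_of_tendsto _ h).exists_norm_le
  obtain ⟨D, hD⟩ := exists_norm_eulerPartialInv_le hp
  have hC' : ∀ n, ‖eulerPartial p n‖ ≤ C := fun n => hC _ ⟨n, rfl⟩
  have hC0 : 0 ≤ C := (norm_nonneg _).trans (hC' 0)
  have hD0 : 0 ≤ D := (norm_nonneg _).trans (hD 0)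
  refine ⟨C * D * D, fun N j => ?_⟩
  rw [centralGaussBinom, norm_mul, norm_mul]
  gcongr
  exacts [hC' _, hD _, hD _]

lemma tendsto_centralGaussBinom {p E : ℂ} (hE : E ≠ 0)
    (h : Tendsto (eulerPartial p) atTop (𝓝 E)) (j : ℤ) :
    Tendsto (fun N : ℕ => centralGaussBinom p N j) atTop (𝓝 E⁻¹) := by
  have hinv : Tendsto (eulerPartialInv p) atTop (𝓝 E⁻¹) := by
    have h1 : Tendsto Int.toNat atTop atTop :=
      tendsto_atTop.mpr fun b => by
        filter_upwards [eventually_ge_atTop (b : ℤ)] with m hm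
        omega
    refine ((h.inv₀ hE).comp h1).congr' ?_
    filter_upwards [eventually_ge_atTop 0] with m hm
    simp [eulerPartialInv, hm]
  have hcast : Tendsto (fun N : ℕ => (N : ℤ)) atTop atTop := tendsto_natCast_atTop_atTop
  have hadd := hinv.comp (tendsto_atTop_add_const_right _ j hcast)
  have hsub := hinv.comp (tendsto_atTop_add_const_right _ (-j) hcast)
  have hdbl : Tendsto (fun N : ℕ => 2 * N) atTop atTop :=
    tendsto_id.const_mul_atTop' two_pos
  have := ((h.comp hdbl).mul hadd).mul hsub
  rw [mul_inv_cancel₀ hE, one_mul] at this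
  simpa [centralGaussBinom, Function.comp_def, sub_eq_add_neg] using this

lemma centralGaussBinom_succ {x : ℂ} (hx0 : x ≠ 0) (hx : ‖x‖ < 1) (N : ℕ) (j : ℤ) :
    centralGaussBinom (x ^ 2) (N + 1) j * x ^ (j ^ 2) =
      (1 + x ^ (4 * N + 2)) * (centralGaussBinom (x ^ 2) N j * x ^ (j ^ 2)) +
      x ^ (2 * N + 1) * (centralGaussBinom (x ^ 2) N (j - 1) * x ^ ((j - 1) ^ 2) +
        centralGaussBinom (x ^ 2) N (j + 1) * x ^ ((j + 1) ^ 2)) := by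
  have hp : ‖x ^ 2‖ < 1 := by
    rw [norm_pow]; exact pow_lt_one₀ (norm_nonneg _) hx two_ne_zero
  have hrec := eulerPartialInv_sub_one hp
  have e1 : (N : ℤ) + j = (N + 1 + j) - 1 := by ring
  have e2 : (N : ℤ) - j = (N + 1 - j) - 1 := by ring
  have e3 : (N : ℤ) + (j - 1) = (N + 1 + j) - 1 - 1 := by ring
  have e4 : (N : ℤ) - (j - 1) = N + 1 - j := by ring
  have e5 : (N : ℤ) + (j + 1) = N + 1 + j := by ring
  have e6 : (N : ℤ) - (j + 1) = (N + 1 - j) - 1 - 1 := by ring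
  have hQ : eulerPartial (x ^ 2) (2 * (N + 1)) =
      eulerPartial (x ^ 2) (2 * N) * (1 - x ^ (4 * N + 2)) * (1 - x ^ (4 * N + 4)) := by
    rw [show 2 * (N + 1) = 2 * N + 1 + 1 by ring]
    simp only [eulerPartial, Finset.prod_range_succ]
    ring
  set u := x ^ j with hu
  have hu0 : u ≠ 0 := zpow_ne_zero _ hx0
  have p1 : (x ^ 2) ^ ((N : ℤ) + 1 + j) = x ^ (2 * N + 2) * u ^ 2 := by
    rw [← zpow_natCast x 2, ← zpow_mul, hu, ← zpow_natCast (x ^ j), ← zpow_mul, ← zpow_natCast,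
      ← zpow_add₀ hx0]
    congr 1; push_cast; ring
  have p2 : (x ^ 2) ^ ((N : ℤ) + 1 - j) = x ^ (2 * N + 2) / u ^ 2 := by
    rw [← zpow_natCast x 2, ← zpow_mul, hu, ← zpow_natCast (x ^ j), ← zpow_mul, ← zpow_natCast,
      ← zpow_sub₀ hx0]
    congr 1; push_cast; ring
  have p3 : (x ^ 2) ^ ((N : ℤ) + 1 + j - 1) = x ^ (2 * N) * u ^ 2 := by
    rw [zpow_sub_one₀ (pow_ne_zero _ hx0), p1, pow_add]; field_simp
  have p4 : (x ^ 2) ^ ((N : ℤ) + 1 - j - 1) = x ^ (2 * N) / u ^ 2 := by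
    rw [zpow_sub_one₀ (pow_ne_zero _ hx0), p2, pow_add]; field_simp
  have s1 : x ^ ((j - 1) ^ 2) = x ^ (j ^ 2) * x / u ^ 2 := by
    rw [hu, ← zpow_natCast (x ^ j), ← zpow_mul, ← zpow_add_one₀ hx0, ← zpow_sub₀ hx0]
    congr 1; push_cast; ring
  have s2 : x ^ ((j + 1) ^ 2) = x ^ (j ^ 2) * x * u ^ 2 := by
    rw [hu, ← zpow_natCast (x ^ j), ← zpow_mul, ← zpow_add_one₀ hx0, ← zpow_add₀ hx0]
    congr 1; push_cast; ring
  simp only [centralGaussBinom]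
  rw [e1, e2, e3, e4, e5, e6, hQ, s1, s2, hrec (_ - 1), hrec (_ - 1), hrec, hrec, p1, p2, p3, p4]
  push_cast
  field_simp
  ring

/-- The finite Jacobi triple product identity. -/
lemma hasSum_centralGaussBinom {x z : ℂ} (hx0 : x ≠ 0) (hx : ‖x‖ < 1) (hz : z ≠ 0) (N : ℕ) :
    HasSum (fun j : ℤ => centralGaussBinom (x ^ 2) N j * (z ^ j * x ^ (j ^ 2)))
      (∏ k ∈ Finset.range N, (1 + z * x ^ (2 * k + 1)) * (1 + z⁻¹ * x ^ (2 * k + 1))) := by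
  induction N with
  | zero =>
    rw [Finset.prod_range_zero]
    convert hasSum_ite_eq (0 : ℤ) (1 : ℂ) using 2 with j
    rcases eq_or_ne j 0 with rfl | hj
    · simp [centralGaussBinom, eulerPartialInv, eulerPartial]
    · rw [if_neg hj]
      rcases lt_or_gt_of_ne hj with h | h
      · simp [centralGaussBinom, eulerPartialInv, not_le.mpr h]
      · simp [centralGaussBinom, eulerPartialInv, not_le.mpr h]
  | succ N ih =>
    have hr := (Equiv.subRight (1 : ℤ)).hasSum_iff.mpr ih
    have hl := (Equiv.addRight (1 : ℤ)).hasSum_iff.mpr ih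
    rw [Finset.prod_range_succ, mul_comm]
    have hsum := ((ih.mul_left (1 + x ^ (4 * N + 2))).add (hr.mul_left (z * x ^ (2 * N + 1)))).add
      (hl.mul_left (z⁻¹ * x ^ (2 * N + 1)))
    have hfactor : (1 + z * x ^ (2 * N + 1)) * (1 + z⁻¹ * x ^ (2 * N + 1)) =
        1 + x ^ (4 * N + 2) + z * x ^ (2 * N + 1) + z⁻¹ * x ^ (2 * N + 1) := by
      field_simp
      ring
    rw [← add_mul, ← add_mul, ← hfactor] at hsum
    refine Eq.subst (motive := fun f => HasSum f _) (funext fun j => Eq.symm ?_) hsum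
    simp only [Function.comp_apply, Equiv.subRight_apply, Equiv.coe_addRight]
    rw [zpow_sub_one₀ hz, zpow_add_one₀ hz]
    have := centralGaussBinom_succ hx0 hx N j
    field_simp
    linear_combination this

lemma summable_norm_thetaSeries {x z : ℂ} (hx : ‖x‖ < 1) (hz : ‖z‖ = 1) :
    Summable fun j : ℤ => ‖z ^ j * x ^ (j ^ 2)‖ := by
  have hs : Summable fun n : ℕ => ‖x‖ ^ (n ^ 2) :=
    (summable_geometric_of_lt_one (norm_nonneg x) hx).of_nonneg_of_le (fun n => by positivity)
      fun n => pow_le_pow_of_le_one (norm_nonneg _) hx.le (Nat.le_self_pow two_ne_zero n)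
  simp only [norm_mul, norm_zpow, hz, one_zpow, one_mul]
  refine Summable.of_nat_of_neg ?_ ?_
  · exact_mod_cast hs
  · simp only [neg_sq]
    exact_mod_cast hs

/-- The Jacobi triple product identity on the unit circle, as a limit of partial products. -/
lemma tendsto_prod_thetaSeries {x z E : ℂ} (hx0 : x ≠ 0) (hx : ‖x‖ < 1) (hz : ‖z‖ = 1)
    (hE : E ≠ 0) (h : Tendsto (eulerPartial (x ^ 2)) atTop (𝓝 E)) :
    Tendsto (fun N => ∏ k ∈ Finset.range N,
      (1 + z * x ^ (2 * k + 1)) * (1 + z⁻¹ * x ^ (2 * k + 1))) atTop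
      (𝓝 (E⁻¹ * thetaSeries z x)) := by
  have hp : ‖x ^ 2‖ < 1 := by
    rw [norm_pow]; exact pow_lt_one₀ (norm_nonneg _) hx two_ne_zero
  have hz0 : z ≠ 0 := by rintro rfl; simp at hz
  obtain ⟨C, hC⟩ := exists_norm_centralGaussBinom_le hp
  simp only [← (hasSum_centralGaussBinom hx0 hx hz0 _).tsum_eq]
  rw [thetaSeries, ← tsum_mul_left]
  refine tendsto_tsum_of_dominated_convergence
    ((summable_norm_thetaSeries hx hz).mul_left C) (fun j => ?_) (.of_forall fun N j => ?_)
  · exact (tendsto_centralGaussBinom hE h j).mul_const _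
  · rw [norm_mul]
    gcongr
    exact hC N j

lemma multipliable_one_add_mul_odd_pow {x : ℂ} (hx : ‖x‖ < 1) (s : ℂ) :
    Multipliable fun k : ℕ => 1 + s * x ^ (2 * k + 1) :=
  multipliable_one_add_of_summable <| by
    simpa using (summable_norm_pow_mul_add hx two_pos 1).mul_left ‖s‖

lemma one_add_odd_pow_ne_zero {x : ℂ} (hx : ‖x‖ < 1) (k : ℕ) : 1 + x ^ (2 * k + 1) ≠ 0 := by
  simpa [Odd.neg_pow ⟨k, rfl⟩] using
    one_sub_pow_ne_zero_of_norm_lt_one (p := -x) (by simpa using hx) (2 * k)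

lemma thetaSeries_one_ne_zero {x : ℂ} (hx0 : x ≠ 0) (hx : ‖x‖ < 1) : thetaSeries 1 x ≠ 0 := by
  have hp : ‖x ^ 2‖ < 1 := by
    rw [norm_pow]; exact pow_lt_one₀ (norm_nonneg _) hx two_ne_zero
  obtain ⟨E, hE, h⟩ := exists_tendsto_eulerPartial hp
  have h1 := tendsto_prod_thetaSeries (z := 1) hx0 hx (by simp) hE h
  have hm : Multipliable fun k : ℕ => 1 + x ^ (2 * k + 1) := by
    simpa using multipliable_one_add_mul_odd_pow hx 1
  have h2 := (hm.hasProd.mul hm.hasProd).tendsto_prod_nat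
  have hne : ∏' k : ℕ, (1 + x ^ (2 * k + 1)) ≠ 0 :=
    tprod_one_add_ne_zero_of_summable (one_add_odd_pow_ne_zero hx)
      (summable_norm_pow_mul_add hx two_pos 1)
  have := tendsto_nhds_unique h1 (by simpa using h2)
  intro h0
  rw [h0, mul_zero] at this
  exact mul_ne_zero hne hne this.symm

/-- The quotient of theta constants as an infinite product. -/
lemma tprod_odd_pow_eq_thetaSeries_div {x : ℂ} (hx0 : x ≠ 0) (hx : ‖x‖ < 1) :
    ∏' n : ℕ, ((1 - x ^ (2 * n + 1)) / (1 + x ^ (2 * n + 1))) ^ 2 =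
      thetaSeries (-1) x / thetaSeries 1 x := by
  have hp : ‖x ^ 2‖ < 1 := by
    rw [norm_pow]; exact pow_lt_one₀ (norm_nonneg _) hx two_ne_zero
  obtain ⟨E, hE, h⟩ := exists_tendsto_eulerPartial hp
  have hT := thetaSeries_one_ne_zero hx0 hx
  have h1 := tendsto_prod_thetaSeries (z := 1) hx0 hx (by simp) hE h
  have h2 := tendsto_prod_thetaSeries (z := -1) hx0 hx (by simp) hE h
  have h3 := h2.div h1 (mul_ne_zero (inv_ne_zero hE) hT)
  have hplus : Multipliable fun k : ℕ => 1 + x ^ (2 * k + 1) := by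
    simpa using multipliable_one_add_mul_odd_pow hx 1
  have hminus : Multipliable fun k : ℕ => 1 - x ^ (2 * k + 1) := by
    simpa [sub_eq_add_neg] using multipliable_one_add_mul_odd_pow hx (-1)
  have hne : ∏' k : ℕ, (1 + x ^ (2 * k + 1)) ≠ 0 :=
    tprod_one_add_ne_zero_of_summable (one_add_odd_pow_ne_zero hx)
      (summable_norm_pow_mul_add hx two_pos 1)
  have hd := hminus.hasProd.div₀ hplus.hasProd hne
  have hd2 := hd.mul hd
  simp only [← pow_two] at hd2
  rw [hd2.tprod_eq]
  refine tendsto_nhds_unique hd2.tendsto_prod_nat ?_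
  have hlim : E⁻¹ * thetaSeries (-1) x / (E⁻¹ * thetaSeries 1 x) =
      thetaSeries (-1) x / thetaSeries 1 x := by field_simp
  rw [← hlim]
  refine h3.congr fun N => ?_
  simp only [Pi.div_apply, ← Finset.prod_div_distrib]
  refine Finset.prod_congr rfl fun k _ => ?_
  rw [div_pow]
  congr 1 <;> norm_num <;> ring

lemma thetaSeries_one_add_neg_one {x : ℂ} (hx : ‖x‖ < 1) :
    thetaSeries 1 x + thetaSeries (-1) x = 2 * thetaSeries 1 (x ^ 4) := by
  have h1 := (summable_norm_thetaSeries (z := 1) hx (by simp)).of_norm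
  have h2 := (summable_norm_thetaSeries (z := -1) hx (by simp)).of_norm
  have hinj : Function.Injective fun j : ℤ => 2 * j := fun a b h => by simpa using h
  simp only [thetaSeries]
  rw [← h1.tsum_add h2, ← tsum_mul_left, ← hinj.tsum_eq]
  · refine tsum_congr fun j => ?_
    rw [(even_two_mul j).neg_one_zpow, one_zpow, one_zpow, ← zpow_natCast x 4, ← zpow_mul]
    push_cast
    ring_nf
  · intro j hj
    rcases Int.even_or_odd j with h | h
    · obtain ⟨k, rfl⟩ := h.exists_two_nsmul
      exact ⟨k, by simp⟩
    · simp [h.neg_one_zpow] at hj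

lemma tsum_int_prod_of_even_add {f : ℤ × ℤ → ℂ} (hf : ∀ m n, Odd (m + n) → f (m, n) = 0) :
    ∑' v : ℤ × ℤ, f v = ∑' v : ℤ × ℤ, f (v.1 + v.2, v.1 - v.2) := by
  have hinj : Function.Injective fun v : ℤ × ℤ => (v.1 + v.2, v.1 - v.2) := by
    rintro ⟨a, b⟩ ⟨c, d⟩ h
    simp only [Prod.mk.injEq] at h ⊢
    omega
  refine (hinj.tsum_eq ?_).symm
  rintro ⟨m, n⟩ hv
  rcases Int.even_or_odd (m + n) with ⟨k, hk⟩ | h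
  · exact ⟨(k, m - k), by simp only [Prod.mk.injEq]; omega⟩
  · exact absurd (hf m n h) hv

lemma hasSum_thetaSeries_mul {x z w : ℂ} (hx0 : x ≠ 0) (hx : ‖x‖ < 1) (hz : ‖z‖ = 1)
    (hw : ‖w‖ = 1) :
    HasSum (fun v : ℤ × ℤ => z ^ v.1 * w ^ v.2 * x ^ (v.1 ^ 2 + v.2 ^ 2))
      (thetaSeries z x * thetaSeries w x) := by
  have h1 := summable_norm_thetaSeries hx hz
  have h2 := summable_norm_thetaSeries hx hw
  rw [thetaSeries, thetaSeries, tsum_mul_tsum_of_summable_norm h1 h2]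
  refine Eq.subst (motive := fun f => HasSum f _) (funext fun v => ?_)
    (summable_mul_of_summable_norm h1 h2).hasSum
  rw [zpow_add₀ hx0]
  ring

lemma thetaSeries_one_sq_add_neg_one_sq {x : ℂ} (hx0 : x ≠ 0) (hx : ‖x‖ < 1) :
    thetaSeries 1 x ^ 2 + thetaSeries (-1) x ^ 2 = 2 * thetaSeries 1 (x ^ 2) ^ 2 := by
  have hp : ‖x ^ 2‖ < 1 := by
    rw [norm_pow]; exact pow_lt_one₀ (norm_nonneg _) hx two_ne_zero
  have h1 := hasSum_thetaSeries_mul (z := 1) (w := 1) hx0 hx (by simp) (by simp)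
  have h2 := hasSum_thetaSeries_mul (z := -1) (w := -1) hx0 hx (by simp) (by simp)
  have h3 := hasSum_thetaSeries_mul (z := 1) (w := 1) (pow_ne_zero 2 hx0) hp (by simp) (by simp)
  have hneg : (-1 : ℂ) ≠ 0 := by norm_num
  rw [pow_two, pow_two, pow_two, ← (h1.add h2).tsum_eq, ← (h3.mul_left 2).tsum_eq,
    tsum_int_prod_of_even_add]
  · refine tsum_congr fun ⟨a, b⟩ => ?_
    simp only [← zpow_add₀ hneg, one_zpow]
    rw [(show Even (a + b + (a - b)) from ⟨a, by ring⟩).neg_one_zpow, ← zpow_natCast x 2,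
      ← zpow_mul]
    push_cast
    ring_nf
  · intro m n h
    simp only [← zpow_add₀ hneg, one_zpow, h.neg_one_zpow]
    ring

lemma thetaSeries_one_mul_neg_one {x : ℂ} (hx0 : x ≠ 0) (hx : ‖x‖ < 1) :
    thetaSeries 1 x * thetaSeries (-1) x = thetaSeries (-1) (x ^ 2) ^ 2 := by
  have hp : ‖x ^ 2‖ < 1 := by
    rw [norm_pow]; exact pow_lt_one₀ (norm_nonneg _) hx two_ne_zero
  have h1 := hasSum_thetaSeries_mul (z := 1) (w := -1) hx0 hx (by simp) (by simp)
  have h2 := hasSum_thetaSeries_mul (z := -1) (w := 1) hx0 hx (by simp) (by simp)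
  have h3 :=
    hasSum_thetaSeries_mul (z := -1) (w := -1) (pow_ne_zero 2 hx0) hp (by simp) (by simp)
  have hneg : (-1 : ℂ) ≠ 0 := by norm_num
  suffices h : thetaSeries 1 x * thetaSeries (-1) x + thetaSeries (-1) x * thetaSeries 1 x =
      2 * (thetaSeries (-1) (x ^ 2) * thetaSeries (-1) (x ^ 2)) by
    linear_combination h / 2
  rw [← (h1.add h2).tsum_eq, ← (h3.mul_left 2).tsum_eq, tsum_int_prod_of_even_add]
  · refine tsum_congr fun ⟨a, b⟩ => ?_
    have hsub : (-1 : ℂ) ^ (a - b) = (-1) ^ (a + b) := by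
      rw [show a + b = a - b + 2 * b by ring, zpow_add₀ hneg, (even_two_mul b).neg_one_zpow,
        mul_one]
    simp only [← zpow_add₀ hneg, one_zpow, hsub]
    rw [← zpow_natCast x 2, ← zpow_mul]
    push_cast
    ring_nf
  · intro m n h
    have : (-1 : ℂ) ^ m = -(-1) ^ n := by
      rcases Int.even_or_odd n with hn | hn
      · rw [hn.neg_one_zpow, (Int.odd_add.mp h |>.mpr hn).neg_one_zpow]
      · rw [hn.neg_one_zpow, (Int.odd_add'.mp h |>.mp hn).neg_one_zpow, neg_neg]
    simp only [one_zpow, this]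
    ring

lemma qpow_ne_zero (τ : ℂ) (r : ℝ) : qpow τ r ≠ 0 := Complex.exp_ne_zero _

lemma norm_qpow_lt_one {τ : ℂ} (hτ : 0 < τ.im) {r : ℝ} (hr : 0 < r) : ‖qpow τ r‖ < 1 := by
  have : 0 < 2 * Real.pi * r * τ.im := by positivity
  rw [qpow, Complex.norm_exp, Real.exp_lt_one_iff]
  simpa using this

lemma qpow_natCast_mul (τ : ℂ) (n : ℕ) (r : ℝ) : qpow τ (n * r) = qpow τ r ^ n := by
  rw [qpow, qpow, ← Complex.exp_nat_mul]
  congr 1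
  push_cast
  ring

lemma bWeb_eq_thetaSeries_div {τ : ℂ} (hτ : 0 < τ.im) :
    bWeb τ = 2 * (thetaSeries (-1) (qpow τ (1 / 4)) / thetaSeries 1 (qpow τ (1 / 4))) := by
  rw [bWeb, ← tprod_odd_pow_eq_thetaSeries_div (qpow_ne_zero _ _)
    (norm_qpow_lt_one hτ (by norm_num))]
  congr! 3 with n
  have h : qpow τ (((n : ℝ) + 1) / 2 - 1 / 4) = qpow τ (1 / 4) ^ (2 * n + 1) := by
    rw [← qpow_natCast_mul]
    congr 1
    push_cast
    ring
  rw [h]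

/-- If `τ` lies in the upper half-plane, then
`(𝔟(τ) + 2)⁴·𝔟(4τ)⁴ = 2⁸·(𝔟(τ)³ + 4𝔟(τ))`. -/
theorem b_quadruplication (τ : ℂ) (hτ : 0 < τ.im) :
    (bWeb τ + 2) ^ 4 * bWeb (4 * τ) ^ 4 = 2 ^ 8 * (bWeb τ ^ 3 + 4 * bWeb τ) := by
  set x := qpow τ (1 / 4) with hxdef
  have hx : ‖x‖ < 1 := norm_qpow_lt_one hτ (by norm_num)
  have hx0 : x ≠ 0 := qpow_ne_zero _ _
  have hx2 : ‖x ^ 2‖ < 1 := by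
    rw [norm_pow]; exact pow_lt_one₀ (norm_nonneg _) hx two_ne_zero
  have hx4 : ‖x ^ 4‖ < 1 := by
    rw [norm_pow]; exact pow_lt_one₀ (norm_nonneg _) hx four_ne_zero
  have hq : qpow (4 * τ) (1 / 4) = x ^ 4 := by
    rw [hxdef, ← qpow_natCast_mul, qpow, qpow]
    congr 1
    push_cast
    ring
  rw [bWeb_eq_thetaSeries_div (τ := 4 * τ) (by simpa using hτ), bWeb_eq_thetaSeries_div hτ, hq,
    ← hxdef]
  have hT := thetaSeries_one_ne_zero hx0 hx
  have hT4 := thetaSeries_one_ne_zero (pow_ne_zero 4 hx0) hx4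
  have hadd := thetaSeries_one_add_neg_one hx
  have hsq := thetaSeries_one_sq_add_neg_one_sq hx0 hx
  have hmul := thetaSeries_one_mul_neg_one hx0 hx
  have hmul2 := thetaSeries_one_mul_neg_one (pow_ne_zero 2 hx0) hx2
  rw [← pow_mul] at hmul2
  norm_num at hmul2
  generalize thetaSeries 1 x = a at *
  generalize thetaSeries (-1) x = b at *
  generalize thetaSeries 1 (x ^ 2) = c at *
  generalize thetaSeries (-1) (x ^ 2) = d at *
  generalize thetaSeries 1 (x ^ 4) = e at *
  generalize thetaSeries (-1) (x ^ 4) = f at *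
  have key : 2 * f ^ 4 = a * b * (a ^ 2 + b ^ 2) := by
    rw [hsq, hmul]
    linear_combination (-2 * (f ^ 2 + c * d)) * hmul2
  have hsum : 2 * (b / a) + 2 = 4 * e / a := by
    field_simp
    linear_combination 2 * hadd
  rw [hsum]
  field_simp
  linear_combination 128 * key
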